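/- arXiv:1602.06622 — 2 statements merged into one kernel-verified Lean document; each statement's English description precedes it below -/
import Mathlib

section
/- If G is a mock threshold graph and e = uv is an edge of G, then the graph G/e obtained by contracting e is mock threshold, where G/e is the simple graph obtained from G by deleting u and v and adding a new vertex adjacent exactly to the vertices of (N(u) ∪ N(v)) \ {u, v}. -/
/-- The degree of the `i`-th vertex of the ordering `v` within the prefix
`{v 0, …, v i}`, i.e. the number of earlier vertices adjacent to `v i`. -/
noncomputable def prefixDegree {n : ℕ} {V : Type*} (G : SimpleGraph V) (v : Fin n ≃ V)
    (i : Fin n) : ℕ :=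
  Nat.card {j : Fin n // j < i ∧ G.Adj (v i) (v j)}

/-- A finite simple graph is mock threshold if there is an ordering `v 0, …, v (n-1)` of its
vertices such that each `v i` has degree `0`, `1`, `(i+1)-2`, or `(i+1)-1` in the subgraph
induced on `{v 0, …, v i}` (a prefix of `i+1` vertices). -/
def IsMockThreshold {V : Type*} [Fintype V] (G : SimpleGraph V) : Prop :=
  ∃ v : Fin (Fintype.card V) ≃ V, ∀ i : Fin (Fintype.card V),
    prefixDegree G v i = 0 ∨ prefixDegree G v i = 1 ∨
    prefixDegree G v i = (i : ℕ) - 1 ∨ prefixDegree G v i = (i : ℕ)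

/-- The graph obtained from `G` by contracting the edge `uv`: delete `u` and `v` and add a
new vertex (represented here by `v`) adjacent exactly to `(N(u) ∪ N(v)) \ {u, v}`. -/
def contractEdge {V : Type*} (G : SimpleGraph V) (u v : V) :
    SimpleGraph {w : V // w ≠ u} :=
  SimpleGraph.fromRel (fun a b =>
    (b.1 = v ∧ (G.Adj u a.1 ∨ G.Adj v a.1)) ∨ (a.1 ≠ v ∧ b.1 ≠ v ∧ G.Adj a.1 b.1))

/-- A ranking `f` of the vertices eliminates `G` if each vertex has at most one neighbour or at
most one non-neighbour among the vertices of smaller rank. -/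
def IsMockRanking {V : Type*} (G : SimpleGraph V) (f : V → ℕ) : Prop :=
  ∀ x, {y | f y < f x ∧ G.Adj x y}.Subsingleton ∨ {y | f y < f x ∧ ¬ G.Adj x y}.Subsingleton

theorem prefixDegree_add_card_nonadj {n : ℕ} {V : Type*} (G : SimpleGraph V) (v : Fin n ≃ V)
    (i : Fin n) :
    prefixDegree G v i + Nat.card {j : Fin n // j < i ∧ ¬ G.Adj (v i) (v j)} = i := by
  classical
  simp only [prefixDegree, Nat.card_eq_fintype_card, Fintype.card_subtype, ← Finset.filter_filter]
  rw [Finset.card_filter_add_card_filter_not]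
  exact (congrArg Finset.card (by ext; simp)).trans (Fin.card_Iio i)

theorem prefixDegree_iff_subsingleton {n : ℕ} {V : Type*} (G : SimpleGraph V) (v : Fin n ≃ V)
    (i : Fin n) :
    (prefixDegree G v i = 0 ∨ prefixDegree G v i = 1 ∨
      prefixDegree G v i = (i : ℕ) - 1 ∨ prefixDegree G v i = (i : ℕ)) ↔
    {j | j < i ∧ G.Adj (v i) (v j)}.Subsingleton ∨
      {j | j < i ∧ ¬ G.Adj (v i) (v j)}.Subsingleton := by
  have hadd := prefixDegree_add_card_nonadj G v i
  have hcard (p : Fin n → Prop) : {j | p j}.Subsingleton ↔ Nat.card {j // p j} ≤ 1 := by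
    rw [Finite.card_le_one_iff_subsingleton, ← Set.subsingleton_coe]
    rfl
  rw [hcard, hcard, ← prefixDegree]
  omega

theorem isMockThreshold_iff_exists_isMockRanking {V : Type*} [Fintype V] (G : SimpleGraph V) :
    IsMockThreshold G ↔ ∃ f : V → ℕ, f.Injective ∧ IsMockRanking G f := by
  simp only [IsMockThreshold, prefixDegree_iff_subsingleton]
  constructor
  · rintro ⟨v, hv⟩
    refine ⟨fun x => v.symm x, Fin.val_injective.comp v.symm.injective, fun x => ?_⟩
    refine (hv (v.symm x)).imp (fun h y hy z hz => ?_) (fun h y hy z hz => ?_) <;>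
      exact v.symm.injective (h (by simpa using hy) (by simpa using hz))
  · rintro ⟨f, hf, hrank⟩
    let : LinearOrder V := LinearOrder.lift' f hf
    have hlt (x y : V) : x < y ↔ f x < f y := Iff.rfl
    let e := Fintype.orderIsoFinOfCardEq V rfl
    refine ⟨e.toEquiv, fun i => ?_⟩
    refine (hrank (e i)).imp (fun h j hj k hk => ?_) (fun h j hj k hk => ?_) <;>
      exact e.injective (h ⟨(hlt _ _).1 (e.lt_iff_lt.2 hj.1), hj.2⟩
        ⟨(hlt _ _).1 (e.lt_iff_lt.2 hk.1), hk.2⟩)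

theorem contractEdge_adj {V : Type*} (G : SimpleGraph V) (u v : V) (a b : {w : V // w ≠ u}) :
    (contractEdge G u v).Adj a b ↔ a.1 ≠ b.1 ∧
      (G.Adj a.1 b.1 ∨ (a.1 = v ∧ G.Adj u b.1) ∨ (b.1 = v ∧ G.Adj u a.1)) := by
  have hab := G.adj_comm a.1 b.1
  rw [contractEdge, SimpleGraph.fromRel_adj, Ne, Subtype.ext_iff]
  grind

/-- The contracted vertex takes over the rank of `u` or that of `v`. -/
theorem IsMockRanking.exists_contractEdge {V : Type*} {G : SimpleGraph V} {f : V → ℕ}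
    (hf : f.Injective) (h : IsMockRanking G f) {u v : V} (huv : G.Adj u v) :
    ∃ g : {w : V // w ≠ u} → ℕ, g.Injective ∧ IsMockRanking (contractEdge G u v) g := by
  classical
  have hne := huv.ne
  have hvu := huv.symm
  have hinj (a b : V) : f a = f b → a = b := @hf a b
  have hsymm (a b : V) : G.Adj a b → G.Adj b a := G.symm.symm a b
  suffices ∃ p, (p = f u ∨ p = f v) ∧
      IsMockRanking (contractEdge G u v) fun w => if w.1 = v then p else f w by
    obtain ⟨p, hp, hr⟩ := this
    refine ⟨_, fun a b hab => Subtype.ext ?_, hr⟩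
    grind
  simp only [IsMockRanking, Set.Subsingleton, Set.mem_ofPred_eq, contractEdge_adj,
    Subtype.forall, Subtype.mk.injEq] at h ⊢
  rcases lt_or_gt_of_ne (mt (hinj u v) hne) with hlt | hlt
  · rcases h v with hv | hv
    · replace hv (y : V) (hy : f y < f v) (hvy : G.Adj v y) : y = u := hv ⟨hy, hvy⟩ ⟨hlt, hvu⟩
      refine ⟨f u, .inl rfl, fun x hx => ?_⟩
      by_cases hxv : x = v
      · refine (h u).imp ?_ ?_ <;> clear h <;> grind
      · refine (h x).imp (fun hx' => ?_) (fun hx' => ?_) <;> clear h <;>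
          have hxv' := @hx' v <;> grind
    · refine ⟨f v, .inr rfl, fun x hx => ?_⟩
      by_cases hxv : x = v
      · clear h
        grind
      · refine (h x).imp (fun hx' => ?_) (fun hx' => ?_) <;> clear h <;>
          have hxu' := @hx' u <;> grind
  · rcases h u with hu | hu
    · replace hu (y : V) (hy : f y < f u) (huy : G.Adj u y) : y = v := hu ⟨hy, huy⟩ ⟨hlt, huv⟩
      refine ⟨f v, .inr rfl, fun x hx => ?_⟩
      refine (h x).imp (fun hx' => ?_) (fun hx' => ?_) <;> clear h <;>
        have hxu' := @hx' u <;> grind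
    · refine ⟨f u, .inl rfl, fun x hx => ?_⟩
      by_cases hxv : x = v
      · clear h
        grind
      · refine (h x).imp (fun hx' => ?_) (fun hx' => ?_) <;> clear h <;>
          have hxv' := @hx' v <;> grind

theorem mockThreshold_contractEdge {V : Type*} [Fintype V] [DecidableEq V]
    (G : SimpleGraph V) (hG : IsMockThreshold G) (u v : V) (huv : G.Adj u v) :
    IsMockThreshold (contractEdge G u v) := by
  obtain ⟨f, hf, h⟩ := (isMockThreshold_iff_exists_isMockRanking G).1 hG
  exact (isMockThreshold_iff_exists_isMockRanking _).2 (h.exists_contractEdge hf huv)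
end

section
/- Let G be a minimal non-mock-threshold graph on n > 5 vertices that is neither a cycle of length at least 5 nor the complement of such a cycle. Then every vertex of G is either adjacent to some divalent vertex (a vertex of degree exactly 2) or non-adjacent to some co-divalent vertex (a vertex of degree exactly n−3, i.e., with exactly two non-neighbors). -/
/-- A graph is a minimal non-mock-threshold graph if it is not mock threshold but every
proper induced subgraph of it is mock threshold. -/
def IsMinimalNonMockThreshold {V : Type*} [Fintype V] (G : SimpleGraph V) : Prop :=
  ¬ IsMockThreshold G ∧
    ∀ X : Finset V, X ≠ Finset.univ → IsMockThreshold (G.induce (X : Set V))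

open scoped Classical in
theorem prefixDegree_eq_sum {n : ℕ} {V : Type*} (G : SimpleGraph V) (v : Fin n ≃ V) (i : Fin n) :
    prefixDegree G v i = ∑ j, if j < i ∧ G.Adj (v i) (v j) then 1 else 0 := by
  rw [prefixDegree, Nat.card_eq_fintype_card, Fintype.card_subtype, Finset.card_filter]

open scoped Classical in
theorem SimpleGraph.degree_eq_sum_ite {V : Type*} [Fintype V] (G : SimpleGraph V)
    [DecidableRel G.Adj] (v : V) : G.degree v = ∑ w, if G.Adj v w then 1 else 0 := by
  rw [← G.card_neighborFinset_eq_degree, G.neighborFinset_eq_filter, Finset.card_filter]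

/-- The last vertex of an ordering has its full degree as prefix degree. -/
theorem prefixDegree_last {m : ℕ} {V : Type*} [Fintype V] (G : SimpleGraph V)
    [DecidableRel G.Adj] (v : Fin (m + 1) ≃ V) :
    prefixDegree G v (Fin.last m) = G.degree (v (Fin.last m)) := by
  classical
  rw [prefixDegree_eq_sum, G.degree_eq_sum_ite, ← v.sum_comp]
  refine Finset.sum_congr rfl fun j _ => ?_
  obtain rfl | hj := eq_or_ne j (Fin.last m)
  · simp
  · simp [Fin.lt_last_iff_ne_last.2 hj]

theorem isMockThreshold_iff_of_card_eq {V : Type*} [Fintype V] (G : SimpleGraph V) {n : ℕ}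
    (hn : Fintype.card V = n) :
    IsMockThreshold G ↔ ∃ v : Fin n ≃ V, ∀ i : Fin n,
      prefixDegree G v i = 0 ∨ prefixDegree G v i = 1 ∨
      prefixDegree G v i = (i : ℕ) - 1 ∨ prefixDegree G v i = (i : ℕ) := by
  subst hn
  rfl

theorem IsMockThreshold.of_iso {V W : Type*} [Fintype V] [Fintype W] {G : SimpleGraph V}
    {H : SimpleGraph W} (φ : G ≃g H) (h : IsMockThreshold G) : IsMockThreshold H := by
  obtain ⟨v, hv⟩ := h
  refine (isMockThreshold_iff_of_card_eq H (Fintype.card_congr φ.toEquiv).symm).2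
    ⟨v.trans φ.toEquiv, fun i => ?_⟩
  have hi : prefixDegree H (v.trans φ.toEquiv) i = prefixDegree G v i :=
    Nat.card_congr (Equiv.subtypeEquivRight fun _ => and_congr_right' φ.map_adj_iff)
  rw [hi]
  exact hv i

/-- A nonempty mock threshold graph has a vertex of degree `0`, `1`, `n - 2` or `n - 1`. -/
theorem IsMockThreshold.exists_degree {V : Type*} [Fintype V] {G : SimpleGraph V}
    [DecidableRel G.Adj] (h : IsMockThreshold G) {m : ℕ} (hm : Fintype.card V = m + 1) :
    ∃ w, G.degree w = 0 ∨ G.degree w = 1 ∨ G.degree w = m - 1 ∨ G.degree w = m := by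
  obtain ⟨v, hv⟩ := (isMockThreshold_iff_of_card_eq G hm).1 h
  refine ⟨v (Fin.last m), ?_⟩
  simpa only [prefixDegree_last, Fin.val_last] using hv (Fin.last m)

/-- Appending a vertex of degree `0`, `1`, `n - 2` or `n - 1` preserves mock thresholdness. -/
theorem IsMockThreshold.of_comap_ne {V : Type*} [Fintype V] [DecidableEq V] {G : SimpleGraph V}
    [DecidableRel G.Adj] {a : V}
    (h : IsMockThreshold (G.comap (Subtype.val : {x // x ≠ a} → V))) {m : ℕ} (hm : Fintype.card V = m + 1)
    (ha : G.degree a = 0 ∨ G.degree a = 1 ∨ G.degree a = m - 1 ∨ G.degree a = m) :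
    IsMockThreshold G := by
  have hc : Fintype.card {x // x ≠ a} = m := by
    rw [Fintype.card_subtype_compl, Fintype.card_subtype_eq, hm, Nat.add_sub_cancel]
  obtain ⟨e, he⟩ := (isMockThreshold_iff_of_card_eq _ hc).1 h
  let f : Fin (m + 1) ≃ V :=
    finSuccEquivLast.trans ((Equiv.optionCongr e).trans (Equiv.optionSubtypeNe a))
  have hf : ∀ i, f (Fin.castSucc i) = e i := fun i => by simp [f]
  have hl : f (Fin.last m) = a := by simp [f]
  refine (isMockThreshold_iff_of_card_eq G hm).2 ⟨f, fun i => ?_⟩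
  induction i using Fin.lastCases with
  | last => rwa [prefixDegree_last, hl, Fin.val_last]
  | cast i =>
    have hi : prefixDegree G f i.castSucc =
        prefixDegree (G.comap (Subtype.val : {x // x ≠ a} → V)) e i := by
      classical
      rw [prefixDegree_eq_sum, prefixDegree_eq_sum, Fin.sum_univ_castSucc,
        if_neg fun h => (Fin.castSucc_lt_last i).not_gt h.1]
      simp only [hf, Fin.castSucc_lt_castSucc_iff, SimpleGraph.comap_adj, add_zero]
    rw [hi]
    exact he i

theorem SimpleGraph.degree_eq_degree_comap_ne_add {V : Type*} [Fintype V] [DecidableEq V]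
    (G : SimpleGraph V) [DecidableRel G.Adj] (a : V) (w : {x // x ≠ a}) :
    G.degree w =
      (G.comap (Subtype.val : {x // x ≠ a} → V)).degree w + if G.Adj a w then 1 else 0 := by
  classical
  rw [degree_eq_sum_ite, degree_eq_sum_ite, ← (Equiv.optionSubtypeNe a).sum_comp,
    Fintype.sum_option, add_comm]
  simp [G.adj_comm a]

theorem minimal_nonMockThreshold_divalent_or_codivalent {V : Type*} [Fintype V]
    (G : SimpleGraph V) [DecidableRel G.Adj] (hG : IsMinimalNonMockThreshold G)
    (hcard : 5 < Fintype.card V)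
    (hcyc : ∀ n : ℕ, 5 ≤ n → ¬ Nonempty (G ≃g SimpleGraph.cycleGraph n))
    (hcocyc : ∀ n : ℕ, 5 ≤ n → ¬ Nonempty (G ≃g (SimpleGraph.cycleGraph n)ᶜ))
    (v : V) :
    (∃ w : V, G.Adj v w ∧ G.degree w = 2) ∨
    (∃ w : V, w ≠ v ∧ ¬ G.Adj v w ∧ G.degree w = Fintype.card V - 3) := by
  classical
  obtain ⟨hnot, hind⟩ := hG
  obtain ⟨m, hm⟩ : ∃ m, Fintype.card V = m + 2 := ⟨Fintype.card V - 2, by omega⟩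
  have hdel : ∀ a : V, IsMockThreshold (G.comap (Subtype.val : {x // x ≠ a} → V)) := fun a => by
    have hne : (Finset.univ.erase a : Finset V) ≠ Finset.univ := fun h =>
      Finset.notMem_erase a Finset.univ (h.symm ▸ Finset.mem_univ a)
    let φ : G.induce ((Finset.univ.erase a : Finset V) : Set V) ≃g
        G.comap (Subtype.val : {x // x ≠ a} → V) :=
      ⟨Equiv.subtypeEquivRight (by simp), Iff.rfl⟩
    exact (hind _ hne).of_iso φ
  have hdeg : ∀ a : V, ¬ (G.degree a = 0 ∨ G.degree a = 1 ∨ G.degree a = m + 1 - 1 ∨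
      G.degree a = m + 1) := fun a ha => hnot ((hdel a).of_comap_ne hm ha)
  have hc : Fintype.card {x // x ≠ v} = m + 1 := by
    rw [Fintype.card_subtype_compl, Fintype.card_subtype_eq, hm]
    omega
  obtain ⟨w, hw⟩ := (hdel v).exists_degree hc
  have hadd := G.degree_eq_degree_comap_ne_add v w
  have hwd := hdeg w
  by_cases hvw : G.Adj v w
  · rw [if_pos hvw] at hadd
    exact Or.inl ⟨w, hvw, by omega⟩
  · rw [if_neg hvw] at hadd
    exact Or.inr ⟨w, w.2, hvw, by omega⟩
end
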